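/- Let c ∈ 𝒪 with c ≡ 1 (mod 3), and let x, m ∈ 𝒪 with xm coprime to c. Then ∑_{k (c)} e((x k³ + m k)/c) = ∑_{y (c)*} (x⁻¹·y / c)₃ · e((y − m³·(3³·x·y)⁻¹)/c), where the inverses are taken modulo c. -/

import Mathlib

noncomputable section

namespace CubicSeries

open scoped Classical

def ω : ℂ := Complex.exp (2 * Real.pi * Complex.I / 3)

def O : Subring ℂ := Subring.closure {ω}

abbrev OK : Type _ := O

def δ : ℂ := ω - ω ^ 2

def eC (z : ℂ) : ℂ :=
  Complex.exp (2 * Real.pi * Complex.I * (z / δ + (starRingEnd ℂ) (z / δ)))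

def rep {I : Ideal OK} (x : OK ⧸ I) : OK :=
  Function.surjInv Ideal.Quotient.mk_surjective x

/-- `N(c) = |𝒪/(c)|`, the absolute norm. -/
def Nm (c : OK) : ℕ := Nat.card (OK ⧸ Ideal.span {c})

/-- `φ(c) = |(𝒪/(c))ˣ|`. -/
def totient (c : OK) : ℕ := Nat.card ((OK ⧸ Ideal.span {c})ˣ)

/-- a multiplicative inverse modulo `c` (an arbitrary element when `x` is not invertible). -/
def invMod (c x : OK) : OK :=
  rep (Ring.inverse (Ideal.Quotient.mk (Ideal.span {c}) x))

def T (A B c : OK) : ℂ :=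
  ∑ᶠ x : OK ⧸ Ideal.span {c}, eC (((A * rep x ^ 3 + B * rep x : OK) : ℂ) / (c : ℂ))

/-- The cubic residue symbol `(x/π)₃` for a prime element `π` not dividing `3`:
the unique cube root of unity congruent to `x^{(N(π)-1)/3}` mod `π`, and `0` if `π ∣ x`. -/
def cubicCharP (π x : OK) : OK :=
  if h : ∃ ζ : OK, ζ ^ 3 = 1 ∧ π ∣ ζ - x ^ ((Nm π - 1) / 3) ∧ ¬ π ∣ x then h.choose else 0

/-- The cubic residue symbol `(x/c)₃` for `c` coprime to `3`, defined via a factorization of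
`c` into a unit times prime elements (with multiplicity). -/
def cubicChar (c x : OK) : OK :=
  if h : ∃ fs : OKˣ × Multiset OK, (∀ π ∈ fs.2, Prime π) ∧ c = (fs.1 : OK) * fs.2.prod
  then (h.choose.2.map fun π => cubicCharP π x).prod
  else 0

/-- The cubic Gauss sum `g(a,c) = ∑_{x (c)*} (x/c)₃ e(ax/c)`. -/
def gaussSum (a c : OK) : ℂ :=
  ∑ᶠ u : (OK ⧸ Ideal.span {c})ˣ,
    ((cubicChar c (rep u.val) : OK) : ℂ) * eC (((a * rep u.val : OK) : ℂ) / (c : ℂ))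

/-- The Möbius function: `μ(c) = (−1)^r` if `(c)` is a product of `r` distinct prime ideals,
and `μ(c) = 0` otherwise. -/
def moebius (c : OK) : ℤ :=
  if h : ∃ s : Finset (Ideal OK), (∀ P ∈ s, Prime P) ∧ Ideal.span {c} = ∏ P ∈ s, P
  then (-1) ^ h.choose.card
  else 0

/-- `p^n` modulo `c`, where a negative exponent means the inverse of `p^{-n}` mod `c`. -/
def ppow (c p : OK) (n : ℤ) : OK :=
  if 0 ≤ n then p ^ n.toNat else invMod c (p ^ (-n).toNat)

/-- A choice of generator of a (principal) ideal. -/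
def gen (J : Ideal OK) : OK := if h : ∃ q : OK, Ideal.span {q} = J then h.choose else 0

/-- A choice of cofactor: `cofactor c q` is a `d` with `c = q·d`, when one exists. -/
def cofactor (c q : OK) : OK := if h : ∃ d : OK, c = q * d then h.choose else 0



def PP (R : Type*) [CommRing R] (χ : R → ℂ) : Prop :=
  ∀ ψ : AddChar R ℂ, ψ.IsPrimitive → ∀ n : Rˣ,
    ∑ᶠ k : R, ψ (k ^ 3 - 3 * n * k) =
      ∑ᶠ w : Rˣ, χ w * ψ ((w : R) + (n : R) ^ 3 * ((w⁻¹ : Rˣ) : R))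

/-- If the Cardano equation has a solution `k`, then the resolvent root `w` is a cube. -/
lemma cardano_cube {F : Type*} [Field F] (n k w : F) (hw0 : w ≠ 0)
    (h : k ^ 3 - 3 * n * k = w + n ^ 3 * w⁻¹) : ∃ u, u ^ 3 = w := by
  have h' : w ^ 2 - (k ^ 3 - 3 * n * k) * w + n ^ 3 = 0 := by
    rw [h]; field_simp; ring
  by_cases hk : k ^ 2 = n
  · subst hk
    refine ⟨-k, ?_⟩
    have : (w + k ^ 3) ^ 2 = 0 := by linear_combination h'
    have := pow_eq_zero_iff (two_ne_zero) |>.1 this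
    linear_combination -this
  · have hk' : k ^ 2 - n ≠ 0 := sub_ne_zero.2 hk
    refine ⟨(w + k * n) / (k ^ 2 - n), ?_⟩
    rw [div_pow, div_eq_iff (pow_ne_zero _ hk')]
    linear_combination (w + 3 * k * n + (k ^ 3 - 3 * n * k)) * h'

lemma field_key {F : Type*} [Field F] [Fintype F] (z : F) (hz : z ^ 2 + z + 1 = 0)
    (h3 : (3 : F) ≠ 0) (χ : F → ℂ)
    (hmul : ∀ a b, a ≠ 0 → b ≠ 0 → χ (a * b) = χ a * χ b)
    (hcube : ∀ a, a ≠ 0 → (χ a = 1 ↔ ∃ u, u ^ 3 = a)) (n : Fˣ) (t : F) :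
    ∃ g : ℝ, (∑ w ∈ Finset.univ.filter (fun w : Fˣ => (w : F) + (n : F) ^ 3 * ((w⁻¹ : Fˣ) : F) = t), χ w) = g ∧
      ((Finset.univ.filter fun k : F => k ^ 3 - 3 * n * k = t).card : ℝ) - 1 ≤ g := by
  have hn : (n : F) ≠ 0 := n.ne_zero
  by_cases hex : ∃ w : Fˣ, (w : F) + (n : F) ^ 3 * ((w⁻¹ : Fˣ) : F) = t
  · obtain ⟨w, hw⟩ := hex
    have hw0 : (w : F) ≠ 0 := w.ne_zero
    have hset : (Finset.univ.filter fun w : Fˣ => (w : F) + (n : F) ^ 3 * ((w⁻¹ : Fˣ) : F) = t)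
        = {w, n ^ 3 * w⁻¹} := by
      ext v
      have hv0 : (v : F) ≠ 0 := v.ne_zero
      simp only [Finset.mem_filter, Finset.mem_univ, true_and, Finset.mem_insert,
        Finset.mem_singleton, Units.ext_iff, ← hw]
      push_cast
      constructor
      · intro h
        have : ((v : F) - w) * (v - n ^ 3 * (w : F)⁻¹) = 0 := by
          field_simp at h ⊢
          linear_combination h
        rcases mul_eq_zero.1 this with h | h
        · left; linear_combination h
        · right; linear_combination h
      · rintro (h | h)
        · rw [h]
        · rw [h]; field_simp; ring
    have hχinv : χ w * χ ((n : F) ^ 3 * (w : F)⁻¹) = 1 := by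
      rw [← hmul _ _ hw0 (by positivity), mul_left_comm, mul_inv_cancel₀ hw0, mul_one]
      exact (hcube _ (by positivity)).2 ⟨n, rfl⟩
    by_cases hww : (w : F) = n ^ 3 * (w : F)⁻¹
    · have e : w = n ^ 3 * w⁻¹ := by ext; push_cast; exact hww
      have hw2 : (w : F) ^ 2 = n ^ 3 := by field_simp at hww; exact hww
      refine ⟨1, ?_, ?_⟩
      · rw [hset, ← e]
        simp only [Finset.mem_singleton, Finset.insert_eq_of_mem, Finset.sum_singleton]
        rw [Complex.ofReal_one, hcube _ hw0]
        refine ⟨w / n, ?_⟩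
        field_simp
        linear_combination hw2
      · have : (Finset.univ.filter fun k : F => k ^ 3 - 3 * n * k = t) ⊆
            {-((w : F) / n), 2 * ((w : F) / n)} := by
          intro k hk
          simp only [Finset.mem_filter, Finset.mem_univ, true_and, ← hw] at hk
          simp only [Finset.mem_insert, Finset.mem_singleton]
          push_cast at hk
          rw [← hww] at hk
          set u := (w : F) / n with hu
          have hwu : (w : F) = u ^ 3 := by
            rw [hu]; field_simp; linear_combination -hw2
          have hnu : (n : F) = u ^ 2 := by
            rw [hu]; field_simp; linear_combination - hw2
          rw [hwu, hnu] at hk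
          have : (k + u) ^ 2 * (k - 2 * u) = 0 := by linear_combination hk
          rcases mul_eq_zero.1 this with h | h
          · left; have := pow_eq_zero_iff (two_ne_zero) |>.1 h; linear_combination this
          · right; linear_combination h
        have := (Finset.card_le_card this).trans Finset.card_le_two
        have : ((Finset.univ.filter fun k : F => k ^ 3 - 3 * n * k = t).card : ℝ) ≤ 2 := by
          exact_mod_cast this
        linarith
    · have e : w ≠ n ^ 3 * w⁻¹ := by
        intro h; apply hww; simpa using congrArg Units.val h
      have hsum : (∑ w ∈ Finset.univ.filter (fun w : Fˣ => (w : F) + (n : F) ^ 3 * ((w⁻¹ : Fˣ) : F) = t), χ w) =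
          χ w + χ ((n : F) ^ 3 * (w : F)⁻¹) := by
        rw [hset, Finset.sum_pair e]; push_cast; rfl
      rw [hsum]
      by_cases hc : ∃ u, u ^ 3 = (w : F)
      · have h1 : χ w = 1 := (hcube _ hw0).2 hc
        rw [h1, one_mul] at hχinv
        refine ⟨2, by rw [h1, hχinv]; norm_num, ?_⟩
        have : (Finset.univ.filter fun k : F => k ^ 3 - 3 * n * k = t).card ≤ 3 := by
          have hp : (Finset.univ.filter fun k : F => k ^ 3 - 3 * n * k = t) ⊆
              (Polynomial.X ^ 3 + (Polynomial.C (-(3 * (n : F))) * Polynomial.X +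
                Polynomial.C (-t))).roots.toFinset := by
            intro k hk
            simp only [Finset.mem_filter, Finset.mem_univ, true_and] at hk
            rw [Multiset.mem_toFinset, Polynomial.mem_roots]
            · simp [Polynomial.IsRoot]; linear_combination hk
            · apply Polynomial.Monic.ne_zero
              apply Polynomial.monic_X_pow_add
              exact lt_of_le_of_lt Polynomial.degree_linear_le (by norm_num)
          refine (Finset.card_le_card hp).trans ((Multiset.toFinset_card_le _).trans
            ((Polynomial.card_roots' _).trans ?_))
          compute_degree
        have : ((Finset.univ.filter fun k : F => k ^ 3 - 3 * n * k = t).card : ℝ) ≤ 3 := by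
          exact_mod_cast this
        linarith
      · have h1 : χ w ≠ 1 := fun h => hc ((hcube _ hw0).1 h)
        have h13 : χ w ^ 3 = 1 := by
          have := (hcube ((w : F) ^ 3) (by positivity)).2 ⟨w, rfl⟩
          rw [pow_succ, pow_two, hmul _ _ (by positivity) hw0, hmul _ _ hw0 hw0] at this
          rw [← this]; ring
        have h2 : χ w ^ 2 + χ w + 1 = 0 := by
          have : (χ w - 1) * (χ w ^ 2 + χ w + 1) = 0 := by linear_combination h13
          exact (mul_eq_zero.1 this).resolve_left (sub_ne_zero.2 h1)
        refine ⟨-1, ?_, ?_⟩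
        · have : χ ((n : F) ^ 3 * (w : F)⁻¹) = χ w ^ 2 := by
            linear_combination χ w ^ 2 * hχinv - χ ((n : F) ^ 3 * (w : F)⁻¹) * h13
          rw [this]; push_cast; linear_combination h2
        · have : (Finset.univ.filter fun k : F => k ^ 3 - 3 * n * k = t) = ∅ := by
            rw [Finset.filter_eq_empty_iff]
            intro k _ hk
            exact hc (cardano_cube (n : F) k w hw0 (by rw [hk, ← hw]; push_cast; rfl))
          rw [this]; simp
  · refine ⟨0, ?_, ?_⟩
    · have : (Finset.univ.filter fun w : Fˣ =>
          (w : F) + (n : F) ^ 3 * ((w⁻¹ : Fˣ) : F) = t) = ∅ := by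
        rw [Finset.filter_eq_empty_iff]
        intro w _ hw
        exact hex ⟨w, hw⟩
      rw [this]; simp
    · have : (Finset.univ.filter fun k : F => k ^ 3 - 3 * n * k = t).card ≤ 1 := by
        rw [Finset.card_le_one]
        intro a ha b hb
        simp only [Finset.mem_filter, Finset.mem_univ, true_and] at ha hb
        by_contra hab
        apply hex
        have hn3 : a ^ 2 + a * b + b ^ 2 = 3 * n := by
          have : (a - b) * (a ^ 2 + a * b + b ^ 2 - 3 * n) = 0 := by
            linear_combination ha - hb
          have := (mul_eq_zero.1 this).resolve_left (sub_ne_zero.2 hab)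
          linear_combination this
        set u := (a + z * b + z ^ 2 * (-a - b)) / 3 with hu
        set v := (a + z ^ 2 * b + z * (-a - b)) / 3 with hv
        have hz3 : z ^ 3 = 1 := by linear_combination (z - 1) * hz
        have h3u : 3 * u = a + z * b + z ^ 2 * (-a - b) := by rw [hu]; field_simp
        have h3v : 3 * v = a + z ^ 2 * b + z * (-a - b) := by rw [hv]; field_simp
        have hz2 : z ^ 2 = - z - 1 := by linear_combination hz
        have huvs : u + v = a := by
          apply mul_left_cancel₀ h3
          linear_combination h3u + h3v - a * hz
        have huv : u * v = n := by
          apply mul_left_cancel₀ h3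
          apply mul_left_cancel₀ h3
          have : 3 * (3 * (u * v)) = (3 * u) * (3 * v) := by ring
          rw [this, h3u, h3v, hz2]
          ring_nf
          rw [hz2]
          linear_combination 3 * hn3
        have hu0 : u ≠ 0 := by rintro h; rw [h, zero_mul] at huv; exact hn huv.symm
        refine ⟨(Units.mk0 u hu0) ^ 3, ?_⟩
        push_cast
        rw [Units.val_mk0, ← ha, ← huv, ← huvs]
        field_simp
        ring
      have : ((Finset.univ.filter fun k : F => k ^ 3 - 3 * n * k = t).card : ℝ) ≤ 1 := by
        exact_mod_cast this
      linarith

lemma field_case {F : Type*} [Field F] [Finite F] (z : F) (hz : z ^ 2 + z + 1 = 0)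
    (h3 : (3 : F) ≠ 0) (χ : F → ℂ)
    (hmul : ∀ a b, a ≠ 0 → b ≠ 0 → χ (a * b) = χ a * χ b)
    (hcube : ∀ a, a ≠ 0 → (χ a = 1 ↔ ∃ u, u ^ 3 = a))
    (hnt : ∃ a, a ≠ 0 ∧ χ a ≠ 1) : PP F χ := by
  have := Fintype.ofFinite F
  intro ψ hψ n
  rw [finsum_eq_sum_of_fintype, finsum_eq_sum_of_fintype]
  choose g hg hNg using field_key z hz h3 χ hmul hcube n
  set N : F → ℕ := fun t => (Finset.univ.filter fun k : F => k ^ 3 - 3 * n * k = t).card with hN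
  have hχsum : ∑ w : Fˣ, χ w = 0 := by
    obtain ⟨a, ha, ha1⟩ := hnt
    have : χ a * ∑ w : Fˣ, χ w = ∑ w : Fˣ, χ w := by
      rw [Finset.mul_sum, ← Equiv.sum_comp (Equiv.mulLeft (Units.mk0 a ha)) (fun w : Fˣ => χ w)]
      refine Finset.sum_congr rfl fun w _ => ?_
      simp [hmul a w ha w.ne_zero]
    have h : (χ a - 1) * ∑ w : Fˣ, χ w = 0 := by linear_combination this
    exact (mul_eq_zero.1 h).resolve_left (sub_ne_zero.2 ha1)
  have hgs : ∑ t, g t = 0 := by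
    have : ((∑ t, g t : ℝ) : ℂ) = 0 := by
      push_cast
      rw [← hχsum, ← Finset.sum_fiberwise Finset.univ
        (fun w : Fˣ => (w : F) + (n : F) ^ 3 * ((w⁻¹ : Fˣ) : F))]
      exact Finset.sum_congr rfl fun t _ => (hg t).symm
    exact_mod_cast this
  have hNs : ∑ t, ((N t : ℝ) - 1) = 0 := by
    have h : ∑ t, N t = Fintype.card F :=
      (Finset.card_eq_sum_card_fiberwise (f := fun k : F => k ^ 3 - 3 * n * k)
        (s := Finset.univ) (t := Finset.univ) (by simp)).symm
    rw [Finset.sum_sub_distrib, ← Nat.cast_sum, h]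
    simp
  have heq : ∀ t, (N t : ℝ) - 1 = g t := by
    have := (Finset.sum_eq_sum_iff_of_le (fun t (_ : t ∈ Finset.univ) => hNg t)).1
      (hNs.trans hgs.symm)
    exact fun t => this t (Finset.mem_univ t)
  have hψs : ∑ t, ψ t = 0 := by
    have := AddChar.sum_mulShift (1 : F) hψ
    simpa using this
  have hL : ∑ k : F, ψ (k ^ 3 - 3 * n * k) = ∑ t, (N t : ℂ) * ψ t := by
    rw [← Finset.sum_fiberwise Finset.univ (fun k : F => k ^ 3 - 3 * n * k)]
    refine Finset.sum_congr rfl fun t _ => ?_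
    rw [← nsmul_eq_mul, ← Finset.sum_const]
    refine Finset.sum_congr rfl fun k hk => ?_
    rw [(Finset.mem_filter.1 hk).2]
  have hR : ∑ w : Fˣ, χ w * ψ ((w : F) + (n : F) ^ 3 * ((w⁻¹ : Fˣ) : F)) =
      ∑ t, (g t : ℂ) * ψ t := by
    rw [← Finset.sum_fiberwise Finset.univ
        (fun w : Fˣ => (w : F) + (n : F) ^ 3 * ((w⁻¹ : Fˣ) : F))]
    refine Finset.sum_congr rfl fun t _ => ?_
    rw [← hg t, Finset.sum_mul]
    refine Finset.sum_congr rfl fun w hw => ?_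
    rw [(Finset.mem_filter.1 hw).2]
  rw [hL, hR, ← sub_eq_zero, ← Finset.sum_sub_distrib, ← hψs]
  refine Finset.sum_congr rfl fun t _ => ?_
  rw [← heq t]
  push_cast
  ring


lemma local_case {R : Type*} [CommRing R] [Finite R] (z : R) (hz : z ^ 2 + z + 1 = 0)
    (h3 : IsUnit (3 : R)) (χ : R → ℂ) (p : R) (hp0 : p ≠ 0) (hpp : p * p = 0)
    (hp : ∀ r, p * r = 0 ∨ IsUnit r)
    (hχ : ∀ a b, p * (a - b) = 0 → χ a = χ b)
    (hχ3 : ∀ u : Rˣ, χ ((u : R) ^ 3) = 1) : PP R χ := by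
  have := Fintype.ofFinite R
  intro ψ hψ n
  rw [finsum_eq_sum_of_fintype, finsum_eq_sum_of_fintype]
  have hnu : ∀ r, IsUnit r → p * r ≠ 0 := by
    intro r hr h
    exact hp0 ((hr.mul_left_eq_zero).1 h)
  have hunit : ∀ r s, IsUnit r → p * (r - s) = 0 → IsUnit s := by
    intro r s hr h
    refine (hp s).resolve_left fun hs => hnu r hr ?_
    linear_combination h + hs
  have hcard : (Fintype.card R : ℂ) ≠ 0 := Nat.cast_ne_zero.2 Fintype.card_ne_zero
  -- the left-hand side
  have hL : ∑ k : R, ψ (k ^ 3 - 3 * n * k) =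
      ∑ k : R, if p * (k ^ 2 - n) = 0 then ψ (k ^ 3 - 3 * n * k) else 0 := by
    apply mul_left_cancel₀ hcard
    have h1 : ∀ h : R, ∑ k : R, ψ (k ^ 3 - 3 * n * k) =
        ∑ k : R, ψ (k ^ 3 - 3 * n * k) * ψ (h * (3 * (p * (k ^ 2 - n)))) := by
      intro h
      rw [← Equiv.sum_comp (Equiv.addRight (p * h))]
      refine Finset.sum_congr rfl fun k _ => ?_
      rw [← AddChar.map_add_eq_mul]
      congr 1
      simp only [Equiv.coe_addRight]
      linear_combination (3 * k * h ^ 2 + p * h ^ 3) * hpp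
    calc (Fintype.card R : ℂ) * ∑ k : R, ψ (k ^ 3 - 3 * n * k)
        = ∑ h : R, ∑ k : R, ψ (k ^ 3 - 3 * n * k) * ψ (h * (3 * (p * (k ^ 2 - n)))) := by
          rw [← Finset.sum_congr rfl (fun h _ => h1 h)]; simp
      _ = _ := by
          rw [Finset.sum_comm, Finset.mul_sum]
          refine Finset.sum_congr rfl fun k _ => ?_
          rw [← Finset.mul_sum, AddChar.sum_mulShift _ hψ]
          simp only [h3.mul_right_eq_zero]
          split_ifs <;> ring
  have hR : ∑ w : Rˣ, χ w * ψ ((w : R) + (n : R) ^ 3 * ((w⁻¹ : Rˣ) : R)) =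
      ∑ w : Rˣ, if p * ((w : R) ^ 2 - n ^ 3) = 0 then
        χ w * ψ ((w : R) + (n : R) ^ 3 * ((w⁻¹ : Rˣ) : R)) else 0 := by
    apply mul_left_cancel₀ hcard
    have h1 : ∀ h : R, ∑ w : Rˣ, χ w * ψ ((w : R) + (n : R) ^ 3 * ((w⁻¹ : Rˣ) : R)) =
        ∑ w : Rˣ, χ w * ψ ((w : R) + (n : R) ^ 3 * ((w⁻¹ : Rˣ) : R)) *
          ψ (h * (((w⁻¹ : Rˣ) : R) * (p * ((w : R) ^ 2 - n ^ 3)))) := by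
      intro h
      let e : Rˣ := ⟨1 + p * h, 1 - p * h, by linear_combination -h ^ 2 * hpp,
        by linear_combination -h ^ 2 * hpp⟩
      rw [← Equiv.sum_comp (Equiv.mulRight e)]
      refine Finset.sum_congr rfl fun w _ => ?_
      rw [mul_assoc, ← AddChar.map_add_eq_mul]
      have he : (e : R) = 1 + p * h := rfl
      have he' : ((e⁻¹ : Rˣ) : R) = 1 - p * h := rfl
      have hw : (w : R) * ((w⁻¹ : Rˣ) : R) = 1 := w.mul_inv
      congr 1
      · apply hχ
        simp only [Equiv.coe_mulRight, Units.val_mul, he]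
        linear_combination w * h * hpp
      · congr 1
        simp only [Equiv.coe_mulRight, Units.val_mul, he, he', mul_inv]
        linear_combination -h * p * w * hw
    calc (Fintype.card R : ℂ) * ∑ w : Rˣ, χ w * ψ ((w : R) + (n : R) ^ 3 * ((w⁻¹ : Rˣ) : R))
        = ∑ h : R, ∑ w : Rˣ, χ w * ψ ((w : R) + (n : R) ^ 3 * ((w⁻¹ : Rˣ) : R)) *
          ψ (h * (((w⁻¹ : Rˣ) : R) * (p * ((w : R) ^ 2 - n ^ 3)))) := by
          rw [← Finset.sum_congr rfl (fun h _ => h1 h)]; simp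
      _ = _ := by
          rw [Finset.sum_comm, Finset.mul_sum]
          refine Finset.sum_congr rfl fun k _ => ?_
          rw [← Finset.mul_sum, AddChar.sum_mulShift _ hψ]
          simp only [Units.mul_right_eq_zero]
          split_ifs <;> ring
  have hLS : ∑ k : R, (if p * (k ^ 2 - n) = 0 then ψ (k ^ 3 - 3 * n * k) else 0) =
      ∑ k : Rˣ, (if p * ((k : R) ^ 2 - n) = 0 then ψ ((k : R) ^ 3 - 3 * n * k) else 0) := by
    symm
    apply Finset.sum_of_injOn (fun u : Rˣ => (u : R)) Units.val_injective.injOn (by simp)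
    · intro k _ hk
      rw [if_neg]
      intro h
      apply hk
      have : IsUnit (k ^ 2) := hunit n _ n.isUnit (by linear_combination -h)
      rw [isUnit_pow_iff two_ne_zero] at this
      simpa using ⟨this.unit, rfl⟩
    · intro u _; rfl
  rw [hL, hR, hLS, ← Finset.sum_filter, ← Finset.sum_filter]
  set S := Finset.univ.filter fun u : Rˣ => p * ((u : R) ^ 2 - n) = 0 with hS
  set Tt := Finset.univ.filter fun w : Rˣ => p * ((w : R) ^ 2 - n ^ 3) = 0 with hT
  have memS : ∀ u : Rˣ, u ∈ S ↔ p * ((u : R) ^ 2 - n) = 0 := by simp [hS]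
  have memT : ∀ u : Rˣ, u ∈ Tt ↔ p * ((u : R) ^ 2 - n ^ 3) = 0 := by simp [hT]
  have hcTS : Tt.card = S.card := by
    symm
    apply Finset.card_bij (fun u _ => n * u)
    · intro u hu
      rw [memS] at hu; rw [memT]; push_cast
      linear_combination n ^ 2 * hu
    · intro a _ b _ h; exact mul_left_cancel h
    · intro w hw
      rw [memT] at hw
      refine ⟨n⁻¹ * w, ?_, by simp⟩
      rw [memS]
      push_cast
      have hn : (n : R) * ((n⁻¹ : Rˣ) : R) = 1 := n.mul_inv
      apply (n ^ 2).isUnit.mul_left_cancel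
      push_cast
      linear_combination hw + p * w ^ 2 * ((n : R) * ((n⁻¹ : Rˣ) : R) + 1) * hn
  -- cubing is a bijection from S onto T
  have hSdiff : ∀ u v : Rˣ, u ∈ S → v ∈ S → p * ((u : R) ^ 3 - v ^ 3) = 0 →
      p * ((u : R) - v) = 0 := by
    intro u v hu hv h
    rw [memS] at hu hv
    apply n.isUnit.mul_left_cancel
    linear_combination h - u * hu + v * hv
  have hcubeinj : Set.InjOn (fun u : Rˣ => u ^ 3) S := by
    intro u hu v hv h
    have h' : (u : R) ^ 3 = v ^ 3 := by simpa using congrArg Units.val h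
    have huv := hSdiff u v hu hv (by rw [h']; ring)
    have hun : IsUnit ((u : R) ^ 2 + u * v + v ^ 2) := by
      apply hunit (3 * (u : R) ^ 2) _ (h3.mul (u.isUnit.pow 2))
      linear_combination (2 * u + v) * huv
    ext
    rw [← sub_eq_zero]
    apply hun.mul_right_cancel
    linear_combination h'
  have hcubeimg : S.image (fun u : Rˣ => u ^ 3) = Tt := by
    apply Finset.eq_of_subset_of_card_le
    · intro w hw
      obtain ⟨u, hu, rfl⟩ := Finset.mem_image.1 hw
      rw [memS] at hu
      rw [memT]; push_cast
      linear_combination ((u : R) ^ 4 + u ^ 2 * n + n ^ 2) * hu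
    · rw [Finset.card_image_of_injOn hcubeinj, hcTS]
  have hz3 : z ^ 3 = 1 := by linear_combination (z - 1) * hz
  have hzu : IsUnit (z - z ^ 2) := by
    rw [← isUnit_pow_iff two_ne_zero]
    have : (z - z ^ 2) ^ 2 = -3 := by linear_combination (z ^ 2 - 3 * z + 3) * hz
    rw [this]; exact h3.neg
  -- the map `u ↦ z u + z² n / u`
  have hφu : ∀ u ∈ S, IsUnit (z * (u : R) + z ^ 2 * n * ((u⁻¹ : Rˣ) : R)) := by
    intro u hu
    rw [memS] at hu
    have hui : (u : R) * ((u⁻¹ : Rˣ) : R) = 1 := u.mul_inv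
    apply hunit (-(u : R)) _ u.isUnit.neg
    linear_combination -p * u * hz + ((u⁻¹ : Rˣ) : R) * z ^ 2 * hu - p * z ^ 2 * u * hui
  let φ : Rˣ → Rˣ := fun u => if hu : u ∈ S then (hφu u hu).unit else u
  have hφ : ∀ u ∈ S, ((φ u : Rˣ) : R) = z * (u : R) + z ^ 2 * n * ((u⁻¹ : Rˣ) : R) := by
    intro u hu
    simp only [φ, dif_pos hu, IsUnit.unit_spec]
  have hφneg : ∀ u ∈ S, p * ((φ u : R) + u) = 0 := by
    intro u hu
    rw [hφ u hu]
    rw [memS] at hu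
    have hui : (u : R) * ((u⁻¹ : Rˣ) : R) = 1 := u.mul_inv
    linear_combination p * u * hz - ((u⁻¹ : Rˣ) : R) * z ^ 2 * hu + p * z ^ 2 * u * hui
  have hφS : ∀ u ∈ S, φ u ∈ S := by
    intro u hu
    have h1 := hφneg u hu
    rw [memS] at hu ⊢
    linear_combination hu + ((φ u : R) - u) * h1
  have hφinj : Set.InjOn φ S := by
    intro u hu v hv h
    have hu' : u ∈ S := hu
    have hv' : v ∈ S := hv
    have huv : p * ((u : R) - v) = 0 := by
      have a := hφneg u hu
      have b := hφneg v hv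
      rw [h] at a
      linear_combination a - b
    have e : (φ u : R) = φ v := by rw [h]
    rw [hφ u hu, hφ v hv] at e
    have hui : (u : R) * ((u⁻¹ : Rˣ) : R) = 1 := u.mul_inv
    have hvi : (v : R) * ((v⁻¹ : Rˣ) : R) = 1 := v.mul_inv
    rw [memS] at hu' hv'
    have hun : IsUnit (z * u * v - z ^ 2 * n) := by
      apply hunit ((z - z ^ 2) * n) _ (hzu.mul n.isUnit)
      linear_combination -z * hu' + z * u * huv
    ext
    rw [← sub_eq_zero]
    apply hun.mul_right_cancel
    linear_combination u * v * e - z ^ 2 * n * v * hui + z ^ 2 * n * u * hvi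
  have hφimg : S.image φ = S := by
    apply Finset.eq_of_subset_of_card_le
    · intro w hw
      obtain ⟨u, hu, rfl⟩ := Finset.mem_image.1 hw
      exact hφS u hu
    · rw [Finset.card_image_of_injOn hφinj]
  rw [← hcubeimg, Finset.sum_image hcubeinj]
  conv_lhs => rw [← hφimg]
  rw [Finset.sum_image hφinj]
  refine Finset.sum_congr rfl fun u hu => ?_
  rw [Units.val_pow_eq_pow_val, hχ3, one_mul, hφ u hu]
  congr 1
  have hui : (u : R) * ((u⁻¹ : Rˣ) : R) = 1 := u.mul_inv
  push_cast [inv_pow]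
  set v := ((u⁻¹ : Rˣ) : R)
  have hz4 : z ^ 6 = 1 := by linear_combination (z ^ 3 + 1) * hz3
  linear_combination (u ^ 3 + 3 * z * n * u * (u * v) + 3 * z^2 * n ^ 2 * v * (u * v) ) * hz3 +
    n ^ 3 * v ^ 3 * hz4 + (3 * z * n * u + 3 * z ^ 2 * n ^ 2 * v) * hui

lemma PP_congr {R : Type*} [CommRing R] {χ χ' : R → ℂ} (h : ∀ u : Rˣ, χ u = χ' u)
    (hP : PP R χ) : PP R χ' := by
  intro ψ hψ n
  simp only [← h]
  exact hP ψ hψ n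

lemma PP_equiv {R S : Type*} [CommRing R] [CommRing S] (e : R ≃+* S) (χ : S → ℂ)
    (hP : PP S χ) : PP R (fun r => χ (e r)) := by
  intro ψ hψ n
  let ψ' : AddChar S ℂ := ψ.compAddMonoidHom (e.symm : S →+ R)
  have hψ' : ψ'.IsPrimitive := by
    intro a ha h
    apply hψ (a := e.symm a) (by simpa using ha)
    ext r
    have := DFunLike.congr_fun h (e r)
    simpa [ψ', AddChar.mulShift_apply] using this
  have := hP ψ' hψ' (Units.map e n)
  rw [← finsum_comp_equiv e.toEquiv, ← finsum_comp_equiv (Units.mapEquiv e.toMulEquiv).toEquiv] at this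
  have e1 : ∀ k : R, ψ' (e.toEquiv k ^ 3 - 3 * (Units.map (e : R →* S) n : Sˣ) * e.toEquiv k) =
      ψ (k ^ 3 - 3 * n * k) := by
    intro k
    have h3 : e.symm 3 = 3 := map_ofNat e.symm 3
    simp [ψ', h3]
  have e2 : ∀ w : Rˣ, ψ' (((Units.mapEquiv e.toMulEquiv).toEquiv w : Sˣ) +
      ((Units.map (e : R →* S) n : Sˣ) : S) ^ 3 *
      ((((Units.mapEquiv e.toMulEquiv).toEquiv w)⁻¹ : Sˣ) : S)) =
      ψ ((w : R) + (n : R) ^ 3 * ((w⁻¹ : Rˣ) : R)) := by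
    intro w
    have : ((((Units.mapEquiv e.toMulEquiv).toEquiv w)⁻¹ : Sˣ) : S) = e ((w⁻¹ : Rˣ) : R) := rfl
    rw [this]
    simp [ψ']
  simp only [e1, e2] at this
  rw [this]
  rfl

lemma PP_prod {R S : Type*} [CommRing R] [CommRing S] [Finite R] [Finite S]
    (χ : R → ℂ) (χ' : S → ℂ) (hR : PP R χ) (hS : PP S χ') :
    PP (R × S) (fun r => χ r.1 * χ' r.2) := by
  have := Fintype.ofFinite R
  have := Fintype.ofFinite S
  intro ψ hψ n
  let ψ1 : AddChar R ℂ := ψ.compAddMonoidHom (AddMonoidHom.inl R S)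
  let ψ2 : AddChar S ℂ := ψ.compAddMonoidHom (AddMonoidHom.inr R S)
  have hsplit : ∀ a b, ψ (a, b) = ψ1 a * ψ2 b := by
    intro a b
    simp only [ψ1, ψ2, AddChar.compAddMonoidHom_apply, ← AddChar.map_add_eq_mul]
    simp
  have h1 : ψ1.IsPrimitive := by
    intro a ha h
    apply hψ (a := (a, 0)) (by simpa using ha)
    ext ⟨r, s⟩
    have := DFunLike.congr_fun h r
    simpa [ψ1, AddChar.mulShift_apply] using this
  have h2 : ψ2.IsPrimitive := by
    intro a ha h
    apply hψ (a := (0, a)) (by simpa using ha)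
    ext ⟨r, s⟩
    have := DFunLike.congr_fun h s
    simpa [ψ2, AddChar.mulShift_apply] using this
  have i1 := hR ψ1 h1 (MulEquiv.prodUnits n).1
  have i2 := hS ψ2 h2 (MulEquiv.prodUnits n).2
  rw [finsum_eq_sum_of_fintype, finsum_eq_sum_of_fintype] at i1 i2 ⊢
  rw [← Equiv.sum_comp (MulEquiv.prodUnits (M := R) (N := S)).symm.toEquiv, Fintype.sum_prod_type,
    Fintype.sum_prod_type]
  have e1 : ∀ k : R, ∀ l : S, ψ ((k, l) ^ 3 - 3 * (n : R × S) * (k, l)) =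
      ψ1 (k ^ 3 - 3 * ((MulEquiv.prodUnits n).1 : R) * k) *
      ψ2 (l ^ 3 - 3 * ((MulEquiv.prodUnits n).2 : S) * l) := by
    intro k l
    rw [← hsplit]
    rfl
  have e2 : ∀ a : Rˣ, ∀ b : Sˣ,
      ψ (((MulEquiv.prodUnits.symm.toEquiv (a, b) : (R × S)ˣ) : R × S) + (n : R × S) ^ 3 *
      (((MulEquiv.prodUnits.symm.toEquiv (a, b))⁻¹ : (R × S)ˣ) : R × S)) =
      ψ1 ((a : R) + ((MulEquiv.prodUnits n).1 : R) ^ 3 * ((a⁻¹ : Rˣ) : R)) *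
      ψ2 ((b : S) + ((MulEquiv.prodUnits n).2 : S) ^ 3 * ((b⁻¹ : Sˣ) : S)) := by
    intro a b
    rw [← hsplit]
    rfl
  have e3 : ∀ a : Rˣ, ∀ b : Sˣ,
    ((MulEquiv.prodUnits.symm.toEquiv (a, b) : (R × S)ˣ)   : R × S) = ((a : R), (b : S)) := fun a b => rfl
  simp only [e1, e2]
  simp only [e3]
  rw [← Fintype.sum_mul_sum, i1, i2, Fintype.sum_mul_sum]
  refine Finset.sum_congr rfl fun a _ => Finset.sum_congr rfl fun b _ => ?_
  ring

lemma PP_trivial {R : Type*} [CommRing R] [Subsingleton R] (χ : R → ℂ) (h : ∀ r, χ r = 1) :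
    PP R χ := by
  have : Fintype R := Fintype.ofSubsingleton 0
  intro ψ _ n
  rw [finsum_eq_sum_of_fintype, finsum_eq_sum_of_fintype]
  have hψ : ∀ r, ψ r = 1 := fun r => by rw [Subsingleton.elim r 0]; exact ψ.map_zero_eq_one
  simp [hψ, h, Fintype.card_eq_one_iff_nonempty_unique]
  exact ⟨⟨⟨0⟩, fun a => Subsingleton.elim _ _⟩⟩


lemma ω_rel : ω ^ 2 + ω + 1 = 0 := by
  have h := (Complex.isPrimitiveRoot_exp 3 (by norm_num))
  have h1 : ω = Complex.exp (2 * Real.pi * Complex.I / (3 : ℕ)) := by simp [ω]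
  rw [← h1] at h
  have h3 := h.pow_eq_one
  have hne : ω ≠ 1 := h.ne_one (by norm_num)
  have : (ω - 1) * (ω ^ 2 + ω + 1) = 0 := by linear_combination h3
  exact (mul_eq_zero.1 this).resolve_left (sub_ne_zero.2 hne)

lemma ω_re_im : ω.re = -1 / 2 ∧ ω.im ^ 2 = 3 / 4 := by
  have h := ω_rel
  have hre := congrArg Complex.re h
  have him := congrArg Complex.im h
  simp [pow_two] at hre him
  have him' : ω.im * (2 * ω.re + 1) = 0 := by linarith
  rcases mul_eq_zero.1 him' with h0 | h0
  · rw [h0] at hre; nlinarith [sq_nonneg (ω.re + 1 / 2)]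
  · have : ω.re = -1 / 2 := by linarith
    refine ⟨this, ?_⟩
    rw [this] at hre; nlinarith

lemma ω_im_ne : ω.im ≠ 0 := by
  intro h
  have := ω_re_im.2
  rw [h] at this; norm_num at this

lemma conj_ω : (starRingEnd ℂ) ω = -1 - ω := by
  have := ω_re_im.1
  apply Complex.ext
  · simp; linarith
  · simp

lemma ω_coords (z : ℂ) : ∃ a b : ℝ, z = a + b * ω := by
  refine ⟨z.re + z.im / ω.im / 2, z.im / ω.im, ?_⟩
  have h := ω_im_ne
  have h' := ω_re_im.1
  apply Complex.ext
  · simp [h']; ring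
  · simp; field_simp

lemma normSq_coords (a b : ℝ) : Complex.normSq (a + b * ω) = a ^ 2 - a * b + b ^ 2 := by
  obtain ⟨h1, h2⟩ := ω_re_im
  rw [Complex.normSq_apply]
  simp [h1]
  linear_combination b ^ 2 * h2

lemma ω_coords_inj {a b a' b' : ℝ} (h : (a : ℂ) + b * ω = a' + b' * ω) : a = a' ∧ b = b' := by
  have him := congrArg Complex.im h
  have hre := congrArg Complex.re h
  simp [ω_im_ne] at him hre
  subst him
  simpa using hre

lemma δ_eq : δ = 1 + 2 * ω := by
  unfold δ; linear_combination -ω_rel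

lemma eC_coords (a b : ℝ) : eC (a + b * ω) = Complex.exp (2 * Real.pi * Complex.I * b) := by
  have hδ : (1 + 2 * ω) ≠ 0 := by
    intro h
    have := congrArg Complex.im h
    simp [ω_im_ne] at this
  unfold eC
  congr 2
  rw [δ_eq]
  simp only [map_div₀, map_add, map_mul, Complex.conj_ofReal, conj_ω, map_one, map_ofNat]
  have hD : 1 + 2 * (-1 - ω) = -(1 + 2 * ω) := by ring
  rw [hD, div_neg, ← sub_eq_add_neg, ← sub_div, div_eq_iff hδ]
  ring

lemma eC_add (z w : ℂ) : eC (z + w) = eC z * eC w := by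
  unfold eC
  rw [← Complex.exp_add, add_div, map_add]
  congr 1; ring

lemma eC_zero : eC 0 = 1 := by simp [eC]

def wK : OK := ⟨ω, Subring.subset_closure rfl⟩

lemma wK_rel : wK ^ 2 + wK + 1 = 0 := Subtype.ext ω_rel

lemma wK_cube : wK ^ 3 = 1 := by linear_combination (wK - 1) * wK_rel

lemma OK_coords (x : OK) : ∃ a b : ℤ, x = a + b * wK := by
  obtain ⟨x, hx⟩ := x
  induction hx using Subring.closure_induction with
  | mem y hy => exact ⟨0, 1, by apply Subtype.ext; simp only [Set.mem_singleton_iff] at hy; simp [hy, wK]⟩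
  | zero => exact ⟨0, 0, by apply Subtype.ext; simp⟩
  | one => exact ⟨1, 0, by apply Subtype.ext; simp⟩
  | add y y' hy hy' h h' =>
    obtain ⟨a, b, h⟩ := h
    obtain ⟨a', b', h'⟩ := h'
    refine ⟨a + a', b + b', ?_⟩
    have : (⟨y + y', add_mem hy hy'⟩ : OK) = ⟨y, hy⟩ + ⟨y', hy'⟩ := rfl
    rw [this, h, h']; push_cast; ring
  | neg y hy h =>
    obtain ⟨a, b, h⟩ := h
    refine ⟨-a, -b, ?_⟩
    have : (⟨-y, neg_mem hy⟩ : OK) = -⟨y, hy⟩ := rfl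
    rw [this, h]; push_cast; ring
  | mul y y' hy hy' h h' =>
    obtain ⟨a, b, h⟩ := h
    obtain ⟨a', b', h'⟩ := h'
    refine ⟨a * a' - b * b', a * b' + a' * b - b * b', ?_⟩
    have : (⟨y * y', mul_mem hy hy'⟩ : OK) = ⟨y, hy⟩ * ⟨y', hy'⟩ := rfl
    rw [this, h, h']; push_cast; linear_combination (b : OK) * b' * wK_rel

lemma OK_val (a b : ℤ) : (((a : OK) + b * wK : OK) : ℂ) = ((a : ℝ) : ℂ) + ((b : ℝ) : ℂ) * ω := by
  push_cast; rfl

lemma eC_int (x : OK) : eC x = 1 := by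
  obtain ⟨a, b, rfl⟩ := OK_coords x
  rw [OK_val, eC_coords, Complex.exp_eq_one_iff]
  exact ⟨b, by push_cast; ring⟩

/-- duality: `O` is self dual for the pairing given by `eC` -/
lemma eC_dual (z : ℂ) (h1 : eC z = 1) (h2 : eC (z * ω) = 1) : ∃ x : OK, z = x := by
  obtain ⟨a, b, rfl⟩ := ω_coords z
  have e : ((a : ℂ) + b * ω) * ω = ((-b : ℝ) : ℂ) + ((a - b : ℝ) : ℂ) * ω := by
    push_cast; linear_combination (b : ℂ) * ω_rel
  rw [e, eC_coords, Complex.exp_eq_one_iff] at h2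
  rw [eC_coords, Complex.exp_eq_one_iff] at h1
  obtain ⟨m, hm⟩ := h1
  obtain ⟨k, hk⟩ := h2
  have hpi : (2 * Real.pi * Complex.I : ℂ) ≠ 0 := Complex.two_pi_I_ne_zero
  have hb : (b : ℂ) = m := by
    apply mul_left_cancel₀ hpi; rw [hm]; ring
  have hab : ((a - b : ℝ) : ℂ) = k := by
    apply mul_left_cancel₀ hpi; rw [hk]; ring
  refine ⟨((k + m : ℤ) : OK) + (m : ℤ) * wK, ?_⟩
  rw [OK_val, hb]
  push_cast at hab ⊢
  linear_combination hab + hb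

lemma normSq_int (x : OK) : ∃ k : ℕ, Complex.normSq x = k := by
  obtain ⟨a, b, rfl⟩ := OK_coords x
  rw [OK_val, normSq_coords]
  have : 0 ≤ a ^ 2 - a * b + b ^ 2 := by nlinarith [sq_nonneg (a - b), sq_nonneg a, sq_nonneg b]
  refine ⟨(a ^ 2 - a * b + b ^ 2).toNat, ?_⟩
  have h : (((a ^ 2 - a * b + b ^ 2).toNat : ℤ) : ℝ) = ((a ^ 2 - a * b + b ^ 2 : ℤ) : ℝ) := by
    rw [Int.toNat_of_nonneg this]
  push_cast at h
  exact h.symm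

lemma euclid (a b : OK) (hb : b ≠ 0) :
    ∃ q : OK, Complex.normSq ((a - q * b : OK) : ℂ) < Complex.normSq b := by
  have hb' : (b : ℂ) ≠ 0 := by simpa using hb
  obtain ⟨α, β, h⟩ := ω_coords ((a : ℂ) / b)
  refine ⟨(round α : ℤ) + (round β : ℤ) * wK, ?_⟩
  have e : ((a - ((round α : ℤ) + (round β : ℤ) * wK) * b : OK) : ℂ) =
      (((α - round α : ℝ) : ℂ) + ((β - round β : ℝ) : ℂ) * ω) * b := by
    have ha : (a : ℂ) = (α + β * ω) * b := by rw [← h]; field_simp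
    have := OK_val (round α) (round β)
    push_cast at this ⊢
    rw [this, ha]
    ring
  rw [e, Complex.normSq_mul, normSq_coords]
  have h0 : 0 < Complex.normSq (b : ℂ) := Complex.normSq_pos.2 hb'
  have h1 := abs_le.1 (abs_sub_round α)
  have h2 := abs_le.1 (abs_sub_round β)
  have : (α - round α) ^ 2 - (α - round α) * (β - round β) + (β - round β) ^ 2 < 1 := by
    generalize α - round α = s at *
    generalize β - round β = t at *
    nlinarith
  nlinarith

instance : IsPrincipalIdealRing OK := by
  refine ⟨fun I => ?_⟩
  by_cases hI : I = ⊥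
  · subst hI; infer_instance
  obtain ⟨x, hx, hx0⟩ := Submodule.exists_mem_ne_zero_of_ne_bot hI
  choose f hf using normSq_int
  obtain ⟨b, ⟨hbI, hb0⟩, hmin⟩ := (measure f).wf.has_min {x : OK | x ∈ I ∧ x ≠ 0} ⟨x, hx, hx0⟩
  refine ⟨b, le_antisymm ?_ ?_⟩
  · intro a ha
    obtain ⟨q, hq⟩ := euclid a b hb0
    rw [← Ideal.span, Ideal.mem_span_singleton]
    by_contra hnd
    refine hmin (a - q * b) ⟨I.sub_mem ha (I.mul_mem_left q hbI), ?_⟩ ?_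
    · intro h; exact hnd ⟨q, by linear_combination h⟩
    · rw [hf, hf] at hq
      exact_mod_cast hq
  · rw [← Ideal.span, Ideal.span_le]; simpa using hbI

instance : Module.Finite ℤ OK := by
  refine ⟨⟨{1, wK}, ?_⟩⟩
  rw [eq_top_iff]
  intro x _
  obtain ⟨a, b, rfl⟩ := OK_coords x
  simp only [Finset.coe_insert, Finset.coe_singleton]
  rw [Submodule.mem_span_pair]
  exact ⟨a, b, by simp⟩

lemma quot_finite (c : OK) (hc : c ≠ 0) : Finite (OK ⧸ Ideal.span {c}) :=
  Ideal.finiteQuotientOfFreeOfNeBot _ (by simpa using hc)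

lemma mk_rep {I : Ideal OK} (r : OK ⧸ I) : Ideal.Quotient.mk I (rep r) = r :=
  Function.surjInv_eq _ r

lemma rep_mk_dvd (c x : OK) : c ∣ rep (Ideal.Quotient.mk (Ideal.span {c}) x) - x := by
  rw [← Ideal.mem_span_singleton, ← Ideal.Quotient.eq, mk_rep]

lemma mk_eq_zero_iff (c x : OK) : Ideal.Quotient.mk (Ideal.span {c}) x = 0 ↔ c ∣ x := by
  rw [Ideal.Quotient.eq_zero_iff_mem, Ideal.mem_span_singleton]

lemma mk_eq_iff (c x y : OK) : Ideal.Quotient.mk (Ideal.span {c}) x =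
    Ideal.Quotient.mk (Ideal.span {c}) y ↔ c ∣ x - y := by
  rw [Ideal.Quotient.eq, Ideal.mem_span_singleton]

/-! ### The cubic residue symbol -/

lemma cubicCharP_congr (π x y : OK) (h : π ∣ x - y) : cubicCharP π x = cubicCharP π y := by
  have hd : π ∣ x ↔ π ∣ y := by
    constructor
    · intro hx; have := dvd_sub hx h; simpa using this
    · intro hy; have := dvd_add h hy; simpa using this
  have h1 : ∀ ζ : OK, π ∣ ζ - x ^ ((Nm π - 1) / 3) ↔ π ∣ ζ - y ^ ((Nm π - 1) / 3) := by
    intro ζ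
    have hp : π ∣ x ^ ((Nm π - 1) / 3) - y ^ ((Nm π - 1) / 3) :=
      h.trans (sub_dvd_pow_sub_pow _ _ _)
    constructor
    · intro hx; have := dvd_add hx hp; simpa using this
    · intro hy; have := dvd_sub hy hp; simpa using this
  unfold cubicCharP
  simp only [h1, hd]

lemma root_uniq (π ζ ζ' : OK) (h3 : ¬ π ∣ 3) (h : ζ ^ 3 = 1) (h' : ζ' ^ 3 = 1)
    (hd : π ∣ ζ - ζ') : ζ = ζ' := by
  by_contra hne
  have h1 : (ζ - ζ') * (ζ ^ 2 + ζ * ζ' + ζ' ^ 2) = 0 := by linear_combination h - h'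
  have h2 := (mul_eq_zero.1 h1).resolve_left (sub_ne_zero.2 hne)
  have h4 : (ζ - ζ') * ((ζ - ζ') * (ζ ^ 2 * ζ' ^ 2)) = -3 := by
    linear_combination ζ ^ 2 * ζ' ^ 2 * h2 - 3 * ζ' ^ 3 * h - 3 * h'
  exact h3 (by rw [← dvd_neg, ← h4]; exact hd.mul_right _)

lemma span_max (π : OK) (hπ : Prime π) : (Ideal.span {π}).IsMaximal :=
  PrincipalIdealRing.isMaximal_of_irreducible hπ.irreducible

lemma card_units_quot (π : OK) (hπ : Prime π) : Nat.card (OK ⧸ Ideal.span {π})ˣ = Nm π - 1 := by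
  have := span_max π hπ
  let _ := Ideal.Quotient.field (Ideal.span {π})
  have := quot_finite π hπ.ne_zero
  have := Fintype.ofFinite (OK ⧸ Ideal.span {π})
  rw [Nm, Nat.card_eq_fintype_card, Nat.card_eq_fintype_card]
  exact Fintype.card_units (OK ⧸ Ideal.span {π})

lemma isUnit_mk_iff (π : OK) (hπ : Prime π) (x : OK) :
    IsUnit (Ideal.Quotient.mk (Ideal.span {π}) x) ↔ ¬ π ∣ x := by
  have := span_max π hπ
  let _ := Ideal.Quotient.field (Ideal.span {π})
  rw [← mk_eq_zero_iff]
  exact isUnit_iff_ne_zero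

lemma three_dvd (π : OK) (hπ : Prime π) (h3 : ¬ π ∣ 3) : 3 ∣ Nm π - 1 := by
  have := quot_finite π hπ.ne_zero
  rw [← card_units_quot π hπ]
  have hu : IsUnit (Ideal.Quotient.mk (Ideal.span {π}) wK) :=
    (IsUnit.of_mul_eq_one (a := wK) (wK ^ 2) (by linear_combination wK_cube)).map _
  have hprime : Fact (Nat.Prime 3) := ⟨Nat.prime_three⟩
  have : orderOf hu.unit = 3 := by
    apply orderOf_eq_prime
    · ext
      simp only [Units.val_pow_eq_pow_val, IsUnit.unit_spec, Units.val_one]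
      rw [← map_pow, wK_cube, map_one]
    · intro h
      have h' := congrArg Units.val h
      simp only [IsUnit.unit_spec, Units.val_one] at h'
      rw [← map_one (Ideal.Quotient.mk (Ideal.span {π})), mk_eq_iff] at h'
      have := root_uniq π wK 1 h3 wK_cube (by ring) h'
      have h1 := wK_rel
      rw [this] at h1
      norm_num at h1
  rw [← this]
  exact orderOf_dvd_natCard _

lemma pow_card_dvd (π : OK) (hπ : Prime π) (x : OK) (hx : ¬ π ∣ x) :
    π ∣ x ^ (Nm π - 1) - 1 := by
  have := quot_finite π hπ.ne_zero
  rw [← mk_eq_iff, map_pow, map_one]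
  have hu := (isUnit_mk_iff π hπ x).2 hx
  have : hu.unit ^ (Nm π - 1) = 1 := by
    rw [← card_units_quot π hπ]; exact pow_card_eq_one'
  simpa using congrArg Units.val this

lemma cubicCharP_spec (π : OK) (hπ : Prime π) (h3 : ¬ π ∣ 3) (x : OK) (hx : ¬ π ∣ x) :
    cubicCharP π x ^ 3 = 1 ∧ π ∣ cubicCharP π x - x ^ ((Nm π - 1) / 3) := by
  have hex : ∃ ζ : OK, ζ ^ 3 = 1 ∧ π ∣ ζ - x ^ ((Nm π - 1) / 3) ∧ ¬ π ∣ x := by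
    set y := x ^ ((Nm π - 1) / 3) with hy
    have hy3 : π ∣ y ^ 3 - 1 := by
      rw [hy, ← pow_mul, Nat.div_mul_cancel (three_dvd π hπ h3)]
      exact pow_card_dvd π hπ x hx
    have hf : y ^ 3 - 1 = (1 - y) * ((wK - y) * (wK ^ 2 - y)) * (-1) := by
      clear_value y
      linear_combination (y ^ 2 - y * wK) * wK_rel + wK_cube
    rw [hf, mul_neg_one, dvd_neg] at hy3
    rcases hπ.dvd_or_dvd hy3 with h | h
    · exact ⟨1, by ring, h, hx⟩
    rcases hπ.dvd_or_dvd h with h | h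
    · exact ⟨wK, wK_cube, h, hx⟩
    · exact ⟨wK ^ 2, by linear_combination (wK ^ 3 + 1) * wK_cube, h, hx⟩
  unfold cubicCharP
  rw [dif_pos hex]
  exact ⟨hex.choose_spec.1, hex.choose_spec.2.1⟩

lemma cubicCharP_eq (π : OK) (hπ : Prime π) (h3 : ¬ π ∣ 3) (x : OK) (hx : ¬ π ∣ x)
    (ζ : OK) (hζ : ζ ^ 3 = 1) (h : π ∣ ζ - x ^ ((Nm π - 1) / 3)) : cubicCharP π x = ζ := by
  obtain ⟨h1, h2⟩ := cubicCharP_spec π hπ h3 x hx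
  apply root_uniq π _ _ h3 h1 hζ
  have := dvd_sub h2 h
  simpa using this

lemma cubicCharP_mul (π : OK) (hπ : Prime π) (h3 : ¬ π ∣ 3) (x y : OK) (hx : ¬ π ∣ x)
    (hy : ¬ π ∣ y) : cubicCharP π (x * y) = cubicCharP π x * cubicCharP π y := by
  obtain ⟨h1, h2⟩ := cubicCharP_spec π hπ h3 x hx
  obtain ⟨h1', h2'⟩ := cubicCharP_spec π hπ h3 y hy
  apply cubicCharP_eq π hπ h3 _ (hπ.not_dvd_mul hx hy)
  · rw [mul_pow, h1, h1', one_mul]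
  · rw [← mk_eq_iff] at h2 h2' ⊢
    rw [map_mul, h2, h2', mul_pow, map_mul]

lemma cubicCharP_cube (π : OK) (hπ : Prime π) (h3 : ¬ π ∣ 3) (x : OK) (hx : ¬ π ∣ x) :
    cubicCharP π (x ^ 3) = 1 := by
  apply cubicCharP_eq π hπ h3 _ (fun h => hx (hπ.dvd_of_dvd_pow h)) _ (by ring)
  rw [← pow_mul, Nat.mul_div_cancel' (three_dvd π hπ h3), ← dvd_neg, neg_sub]
  exact pow_card_dvd π hπ x hx


/-- the product of the symbols over a multiset of primes, on residue classes -/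
def chiS (s : Multiset OK) (x : OK) : ℂ := ((s.map fun π => cubicCharP π x).prod : OK)

lemma chiS_congr (s : Multiset OK) (x y : OK) (h : ∀ π ∈ s, π ∣ x - y) : chiS s x = chiS s y := by
  unfold chiS
  rw [Multiset.map_congr rfl fun π hπ => cubicCharP_congr π x y (h π hπ)]

lemma chiS_add (s t : Multiset OK) (x : OK) : chiS (s + t) x = chiS s x * chiS t x := by
  simp [chiS]

/-- prime case -/
lemma prime_case (π : OK) (hπ : Prime π) (h3 : ¬ π ∣ 3) :
    PP (OK ⧸ Ideal.span {π}) (fun r => chiS {π} (rep r)) := by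
  have hmax := span_max π hπ
  have hfin := quot_finite π hπ.ne_zero
  let _ := Ideal.Quotient.field (Ideal.span {π})
  have hne : ∀ a : OK ⧸ Ideal.span {π}, a ≠ 0 ↔ ¬ π ∣ rep a := by
    intro a; rw [← mk_eq_zero_iff, mk_rep]
  have hone : ∀ a : OK ⧸ Ideal.span {π}, a ≠ 0 →
      (chiS {π} (rep a) = 1 ↔ a ^ ((Nm π - 1) / 3) = 1) := by
    intro a ha
    have ha' := (hne a).1 ha
    have e : chiS {π} (rep a) = 1 ↔ cubicCharP π (rep a) = 1 := by
      simp [chiS]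
    have e2 : a ^ ((Nm π - 1) / 3) = 1 ↔ π ∣ 1 - rep a ^ ((Nm π - 1) / 3) := by
      rw [← mk_eq_iff, map_pow, mk_rep, map_one, eq_comm]
    rw [e, e2]
    constructor
    · intro h
      have := (cubicCharP_spec π hπ h3 _ ha').2
      rwa [h] at this
    · intro h
      exact cubicCharP_eq π hπ h3 _ ha' 1 (by ring) h
  have hq := three_dvd π hπ h3
  have hcard := card_units_quot π hπ
  have hpos : 0 < Nm π - 1 := by rw [← hcard]; exact Nat.card_pos
  obtain ⟨g, hg⟩ := IsCyclic.exists_generator (α := (OK ⧸ Ideal.span {π})ˣ)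
  have hog : orderOf g = Nm π - 1 := by rw [orderOf_eq_card_of_forall_mem_zpowers hg, hcard]
  refine field_case (F := OK ⧸ Ideal.span {π}) (Ideal.Quotient.mk _ wK) ?_ ?_ _ ?_ ?_ ?_
  · have := congrArg (Ideal.Quotient.mk (Ideal.span {π})) wK_rel
    simpa using this
  · intro h
    apply h3
    rw [← mk_eq_zero_iff, map_ofNat]
    exact h
  · intro a b ha hb
    rw [hne] at ha hb
    have : chiS {π} (rep (a * b)) = chiS {π} (rep a * rep b) := by
      apply chiS_congr
      intro p hp
      rw [Multiset.mem_singleton] at hp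
      subst hp
      rw [← mk_eq_iff, map_mul, mk_rep, mk_rep, mk_rep]
    rw [this]
    simp [chiS, cubicCharP_mul π hπ h3 _ _ ha hb]
  · intro a ha
    rw [hone a ha]
    constructor
    · intro h
      obtain ⟨k, hk⟩ := hg (Units.mk0 a ha)
      have h' : (g ^ k) ^ ((Nm π - 1) / 3) = 1 := by
        simp only at hk
        rw [hk]
        ext
        simpa using h
      rw [← zpow_natCast, ← zpow_mul, ← orderOf_dvd_iff_zpow_eq_one, hog] at h'
      obtain ⟨d, hd⟩ := hq
      rw [hd, Nat.mul_div_cancel_left _ (by norm_num)] at h'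
      have hd0 : (d : ℤ) ≠ 0 := by
        intro h0
        have : d = 0 := by exact_mod_cast h0
        rw [this] at hd; omega
      push_cast at h'
      have h3k : (3 : ℤ) ∣ k := Int.dvd_of_mul_dvd_mul_right hd0 h'
      obtain ⟨j, rfl⟩ := h3k
      refine ⟨((g ^ j : (OK ⧸ Ideal.span {π})ˣ) : OK ⧸ Ideal.span {π}), ?_⟩
      rw [← Units.val_pow_eq_pow_val, ← zpow_natCast, ← zpow_mul, mul_comm]
      have := congrArg Units.val hk
      simpa using this
    · rintro ⟨u, rfl⟩
      rw [← pow_mul, Nat.mul_div_cancel' hq, ← hcard]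
      have hu : u ≠ 0 := by rintro rfl; simp at ha
      have : (Units.mk0 u hu) ^ (Nat.card (OK ⧸ Ideal.span {π})ˣ) = 1 := pow_card_eq_one'
      have h' := congrArg Units.val this
      rwa [Units.val_pow_eq_pow_val, Units.val_mk0, Units.val_one] at h'
  · refine ⟨g, g.ne_zero, ?_⟩
    rw [Ne, hone _ g.ne_zero]
    intro h
    have h' : g ^ ((Nm π - 1) / 3) = 1 := by ext; simpa using h
    rw [← orderOf_dvd_iff_pow_eq_one, hog] at h'
    have := Nat.le_of_dvd (Nat.div_pos (Nat.le_of_dvd hpos hq) (by norm_num)) h'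
    omega

/-- prime powers, exponent at least two -/
lemma power_case (π : OK) (hπ : Prime π) (h3 : ¬ π ∣ 3) (a : ℕ) (ha : 2 ≤ a) (s : Multiset OK)
    (hs : ∀ p ∈ s, Associated π p) :
    PP (OK ⧸ Ideal.span {π ^ a}) (fun r => chiS s (rep r)) := by
  have hfin := quot_finite (π ^ a) (pow_ne_zero _ hπ.ne_zero)
  have hsucc : π ^ a = π ^ (a - 1) * π := by rw [← pow_succ]; congr 1; omega
  have hun : ∀ x : OK, ¬ π ∣ x → IsUnit (Ideal.Quotient.mk (Ideal.span {π ^ a}) x) := by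
    intro x hx
    have hc : IsCoprime (π ^ a) x :=
      IsCoprime.pow_left ((Prime.coprime_iff_not_dvd hπ).2 hx)
    obtain ⟨u, v, huv⟩ := hc
    refine IsUnit.of_mul_eq_one (Ideal.Quotient.mk _ v) ?_
    rw [← map_mul, ← map_one (Ideal.Quotient.mk (Ideal.span {π ^ a})), mk_eq_iff]
    exact ⟨-u, by linear_combination huv⟩
  have hzero : ∀ x : OK, Ideal.Quotient.mk (Ideal.span {π ^ a}) (π ^ (a - 1)) *
      Ideal.Quotient.mk _ x = 0 ↔ π ∣ x := by
    intro x
    rw [← map_mul, mk_eq_zero_iff, hsucc]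
    exact mul_dvd_mul_iff_left (pow_ne_zero _ hπ.ne_zero)
  refine local_case (Ideal.Quotient.mk _ wK) ?_ ?_ _
    (Ideal.Quotient.mk _ (π ^ (a - 1))) ?_ ?_ ?_ ?_ ?_
  · have := congrArg (Ideal.Quotient.mk (Ideal.span {π ^ a})) wK_rel
    simpa using this
  · have := hun 3 h3
    rwa [map_ofNat] at this
  · intro h
    have := (hzero 1).1 (by rw [h, zero_mul])
    exact hπ.not_dvd_one this
  · rw [hzero]
    exact dvd_pow_self _ (by omega)
  · intro r
    obtain ⟨x, rfl⟩ := Ideal.Quotient.mk_surjective r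
    rw [hzero]
    by_cases hx : π ∣ x
    · exact Or.inl hx
    · exact Or.inr (hun x hx)
  · intro r t h
    rw [← mk_rep r, ← mk_rep t, ← map_sub, hzero] at h
    exact chiS_congr s _ _ fun p hp => (hs p hp).symm.dvd.trans h
  · intro u
    have hu : ¬ π ∣ rep (u : OK ⧸ Ideal.span {π ^ a}) := by
      intro h
      rw [← hzero, mk_rep, Units.mul_left_eq_zero] at h
      have := (hzero 1).1 (by rw [h, zero_mul])
      exact hπ.not_dvd_one this
    have h1 : chiS s (rep ((u : OK ⧸ Ideal.span {π ^ a}) ^ 3)) =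
        chiS s (rep (u : OK ⧸ Ideal.span {π ^ a}) ^ 3) := by
      apply chiS_congr
      intro p hp
      have hpa : p ∣ π ^ a := (hs p hp).symm.dvd.trans (dvd_pow_self _ (by omega))
      refine hpa.trans ?_
      rw [← mk_eq_iff, map_pow, mk_rep, mk_rep]
    rw [h1]
    unfold chiS
    rw [Multiset.prod_eq_one]
    · rfl
    · intro y hy
      obtain ⟨p, hp, rfl⟩ := Multiset.mem_map.1 hy
      have hpp := hs p hp
      exact cubicCharP_cube p (hpp.prime_iff.1 hπ) (fun h => h3 (hpp.dvd.trans h)) _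
        (fun h => hu (hpp.dvd.trans h))

lemma assoc_prod (π : OK) (s : Multiset OK) (hs : ∀ p ∈ s, Associated π p) :
    Associated (π ^ Multiset.card s) s.prod := by
  induction s using Multiset.induction with
  | empty => simp
  | cons p s ih =>
    rw [Multiset.card_cons, pow_succ', Multiset.prod_cons]
    exact (hs p (Multiset.mem_cons_self p s)).mul_mul
      (ih fun q hq => hs q (Multiset.mem_cons_of_mem hq))

lemma PP_mul (c d : OK) (hc : c ≠ 0) (hd : d ≠ 0) (hcd : IsCoprime c d) (s t : Multiset OK)
    (hs : ∀ p ∈ s, p ∣ c) (ht : ∀ p ∈ t, p ∣ d)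
    (h1 : PP (OK ⧸ Ideal.span {c}) (fun r => chiS s (rep r)))
    (h2 : PP (OK ⧸ Ideal.span {d}) (fun r => chiS t (rep r))) :
    PP (OK ⧸ Ideal.span {c * d}) (fun r => chiS (s + t) (rep r)) := by
  have := quot_finite c hc
  have := quot_finite d hd
  have hI : Ideal.span {c * d} = Ideal.span {c} * Ideal.span {d} :=
    (Ideal.span_singleton_mul_span_singleton c d).symm
  have hco : IsCoprime (Ideal.span {c}) (Ideal.span {d}) :=
    (Ideal.isCoprime_span_singleton_iff c d).2 hcd
  let e : OK ⧸ Ideal.span {c * d} ≃+* (OK ⧸ Ideal.span {c}) × (OK ⧸ Ideal.span {d}) :=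
    (Ideal.quotEquivOfEq hI).trans (Ideal.quotientMulEquivQuotientProd _ _ hco)
  have he : ∀ x : OK, e (Ideal.Quotient.mk _ x) = (Ideal.Quotient.mk _ x, Ideal.Quotient.mk _ x) := by
    intro x
    rfl
  refine PP_congr ?_ (PP_equiv e _ (PP_prod _ _ h1 h2))
  intro u
  obtain ⟨x, hx⟩ := Ideal.Quotient.mk_surjective (u : OK ⧸ Ideal.span {c * d})
  rw [chiS_add, ← hx, he]
  simp only
  have hcdx := rep_mk_dvd (c * d) x
  congr 1
  · apply chiS_congr
    intro p hp
    have a := (hs p hp).trans (rep_mk_dvd c x)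
    have b := (hs p hp).trans ((dvd_mul_right c d).trans hcdx)
    have := dvd_sub a b
    simpa using this
  · apply chiS_congr
    intro p hp
    have a := (ht p hp).trans (rep_mk_dvd d x)
    have b := (ht p hp).trans ((dvd_mul_left d c).trans hcdx)
    have := dvd_sub a b
    simpa using this

lemma PP_main (k : ℕ) : ∀ (s : Multiset OK), Multiset.card s ≤ k → ∀ (u : OKˣ),
    (∀ p ∈ s, Prime p) → (∀ p ∈ s, ¬ p ∣ 3) →
    PP (OK ⧸ Ideal.span {(u : OK) * s.prod}) (fun r => chiS s (rep r)) := by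
  induction k with
  | zero =>
    intro s hs u _ _
    have : s = 0 := by simpa using hs
    subst this
    have : Subsingleton (OK ⧸ Ideal.span {(u : OK) * (0 : Multiset OK).prod}) := by
      rw [Ideal.Quotient.subsingleton_iff, Ideal.span_singleton_eq_top]
      simp
    exact PP_trivial _ (fun r => by simp [chiS])
  | succ k ih =>
    intro s hs u hp h3
    rcases Multiset.empty_or_exists_mem s with rfl | ⟨π, hπs⟩
    · exact ih 0 (by simp) u hp h3
    have hπ := hp π hπs
    set s1 := s.filter (Associated π) with hs1
    set s2 := s.filter (fun p => ¬ Associated π p) with hs2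
    have hs12 : s1 + s2 = s := Multiset.filter_add_not _ _
    have hm1 : ∀ p ∈ s1, Associated π p := fun p h => (Multiset.mem_filter.1 h).2
    have hm2 : ∀ p ∈ s2, p ∈ s ∧ ¬ Associated π p := fun p h => Multiset.mem_filter.1 h
    have hπ1 : π ∈ s1 := Multiset.mem_filter.2 ⟨hπs, Associated.refl _⟩
    have hcard1 : 0 < Multiset.card s1 := Multiset.card_pos_iff_exists_mem.2 ⟨π, hπ1⟩
    have hcard : Multiset.card s1 + Multiset.card s2 = Multiset.card s := by
      rw [← Multiset.card_add, hs12]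
    obtain ⟨v, hv⟩ := assoc_prod π s1 hm1
    set a := Multiset.card s1 with ha
    have hprod : (u : OK) * s.prod = π ^ a * (((u * v : OKˣ) : OK) * s2.prod) := by
      rw [← hs12, Multiset.prod_add, ← hv]; push_cast; ring
    have hi2 := ih s2 (by omega) (u * v) (fun p h => hp p (hm2 p h).1) (fun p h => h3 p (hm2 p h).1)
    have hnd : ¬ π ∣ s2.prod := by
      intro h
      obtain ⟨q, hq, hd⟩ := hπ.exists_mem_multiset_dvd h
      exact (hm2 q hq).2 (hπ.associated_of_dvd (hp q (hm2 q hq).1) hd)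
    have hnd' : ¬ π ∣ ((u * v : OKˣ) : OK) * s2.prod := by
      rwa [Units.dvd_mul_left]
    have hco : IsCoprime (π ^ a) (((u * v : OKˣ) : OK) * s2.prod) :=
      IsCoprime.pow_left ((Prime.coprime_iff_not_dvd hπ).2 hnd')
    have hi1 : PP (OK ⧸ Ideal.span {π ^ a}) (fun r => chiS s1 (rep r)) := by
      rcases Nat.lt_or_ge a 2 with h | h
      · have ha1 : a = 1 := by omega
        obtain ⟨q, hq⟩ := Multiset.card_eq_one.1 (ha.symm.trans ha1)
        have hq' : s1 = {π} := by
          rw [hq] at hπ1 ⊢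
          rw [Multiset.mem_singleton] at hπ1
          rw [hπ1]
        rw [ha1, hq', pow_one]
        exact prime_case π hπ (h3 π hπs)
      · exact power_case π hπ (h3 π hπs) a h s1 hm1
    rw [hprod, ← hs12]
    refine PP_mul _ _ (pow_ne_zero _ hπ.ne_zero) (fun h => hnd' (by rw [h]; exact dvd_zero π)) hco _ _ ?_ ?_
      hi1 hi2
    · intro p hp1
      exact (hm1 p hp1).symm.dvd.trans (dvd_pow_self _ (by omega))
    · intro p hp2
      exact (Multiset.dvd_prod hp2).mul_left _

/-- the additive character `a ↦ e(a/c)` of `𝒪/(c)` -/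
lemma exists_addChar (c : OK) (hc : c ≠ 0) : ∃ ψ : AddChar (OK ⧸ Ideal.span {c}) ℂ,
    ψ.IsPrimitive ∧ ∀ a : OK, ψ (Ideal.Quotient.mk _ a) = eC ((a : ℂ) / (c : ℂ)) := by
  have hc' : (c : ℂ) ≠ 0 := by simpa using hc
  have hdvd : ∀ a b : OK, c ∣ a - b → eC ((a : ℂ) / c) = eC ((b : ℂ) / c) := by
    intro a b ⟨d, hd⟩
    have : (a : ℂ) / c = (b : ℂ) / c + (d : ℂ) := by
      have h : (a : ℂ) - b = c * d := by exact_mod_cast congrArg Subtype.val hd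
      field_simp
      linear_combination h
    rw [this, eC_add, eC_int, mul_one]
  let ψ : AddChar (OK ⧸ Ideal.span {c}) ℂ :=
    { toFun := fun r => eC ((rep r : ℂ) / c)
      map_zero_eq_one' := by
        rw [hdvd _ 0]
        · simp [eC_zero]
        · rw [← mk_eq_iff, mk_rep, map_zero]
      map_add_eq_mul' := by
        intro r t
        rw [hdvd _ (rep r + rep t)]
        · rw [← eC_add]; push_cast; rw [add_div]
        · rw [← mk_eq_iff, map_add, mk_rep, mk_rep, mk_rep] }
  have hψ : ∀ a : OK, ψ (Ideal.Quotient.mk _ a) = eC ((a : ℂ) / (c : ℂ)) :=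
    fun a => hdvd _ _ (rep_mk_dvd c a)
  refine ⟨ψ, ?_, hψ⟩
  intro r hr h
  apply hr
  obtain ⟨a, rfl⟩ := Ideal.Quotient.mk_surjective r
  have key : ∀ b : OK, eC (((a * b : OK) : ℂ) / c) = 1 := by
    intro b
    rw [← hψ, map_mul, ← AddChar.mulShift_apply, h, AddChar.one_apply]
  obtain ⟨d, hd⟩ := eC_dual ((a : ℂ) / c) (by simpa using key 1) (by
    have := key wK
    rw [← this]; congr 1; push_cast
    show (a : ℂ) / c * ω = (a : ℂ) * ω / c
    ring)
  rw [mk_eq_zero_iff]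
  refine ⟨d, Subtype.ext ?_⟩
  push_cast
  rw [← hd]; field_simp

/- Statement 4 -/
theorem stmt4 (c x m : OK) (hc : (3 : OK) ∣ c - 1) (hxm : IsCoprime (x * m) c) :
    (∑ᶠ t : OK ⧸ Ideal.span {c}, eC (((x * rep t ^ 3 + m * rep t : OK) : ℂ) / (c : ℂ))) =
    ∑ᶠ u : (OK ⧸ Ideal.span {c})ˣ,
      ((cubicChar c (invMod c x * rep u.val) : OK) : ℂ) *
        eC (((rep u.val - m ^ 3 * invMod c (3 ^ 3 * x * rep u.val) : OK) : ℂ) / (c : ℂ)) := by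
  have hc0 : c ≠ 0 := by
    rintro rfl
    obtain ⟨d, hd⟩ := hc
    obtain ⟨k, hk⟩ := normSq_int d
    have h1 : ((3 : ℂ) * (d : ℂ)) = -1 := by
      have := congrArg Subtype.val hd
      have h5 : (0 : ℂ) - 1 = 3 * (d : ℂ) := this
      rw [← h5]; ring
    have h2 := congrArg Complex.normSq h1
    rw [Complex.normSq_mul, hk] at h2
    norm_num at h2
    have h4 : 9 * k = 1 := by exact_mod_cast h2
    omega
  have hfin := quot_finite c hc0
  have hfac : ∃ fs : OKˣ × Multiset OK, (∀ π ∈ fs.2, Prime π) ∧ c = (fs.1 : OK) * fs.2.prod := by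
    obtain ⟨f, hf, u, hu⟩ := UniqueFactorizationMonoid.exists_prime_factors c hc0
    exact ⟨(u, f), hf, by rw [← hu]; ring⟩
  obtain ⟨hpr, hprod⟩ := hfac.choose_spec
  set u := hfac.choose.1 with hu
  set s := hfac.choose.2 with hs
  have hchar : ∀ y, ((cubicChar c y : OK) : ℂ) = chiS s y := by
    intro y
    unfold cubicChar
    rw [dif_pos hfac]
    rfl
  have hsc : ∀ p ∈ s, p ∣ c := by
    intro p hp
    rw [hprod]
    exact (Multiset.dvd_prod hp).mul_left _
  have hco3 : IsCoprime (3 : OK) c := by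
    obtain ⟨d, hd⟩ := hc
    exact ⟨-d, 1, by linear_combination hd⟩
  have hs3 : ∀ p ∈ s, ¬ p ∣ 3 := by
    intro p hp h
    exact (hpr p hp).not_isUnit (hco3.isUnit_of_dvd' h (hsc p hp))
  have hP : PP (OK ⧸ Ideal.span {c}) (fun r => chiS s (rep r)) := by
    have := PP_main _ s le_rfl u hpr hs3
    rwa [← hprod] at this
  obtain ⟨ψ, hψ, hψe⟩ := exists_addChar c hc0
  have hun : ∀ y : OK, IsCoprime y c → IsUnit (Ideal.Quotient.mk (Ideal.span {c}) y) := by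
    rintro y ⟨a, b, hab⟩
    refine IsUnit.of_mul_eq_one (Ideal.Quotient.mk _ a) ?_
    rw [← map_mul, ← map_one (Ideal.Quotient.mk (Ideal.span {c})), mk_eq_iff]
    exact ⟨-b, by linear_combination hab⟩
  obtain ⟨X, hX⟩ := hun x hxm.of_mul_left_left
  obtain ⟨M, hM⟩ := hun m hxm.of_mul_left_right
  obtain ⟨t3, ht3⟩ := hun 3 hco3
  have hinv : ∀ y : OK, ∀ Y : (OK ⧸ Ideal.span {c})ˣ, (Y : OK ⧸ Ideal.span {c}) =
      Ideal.Quotient.mk _ y →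
      Ideal.Quotient.mk (Ideal.span {c}) (invMod c y) = ((Y⁻¹ : (OK ⧸ Ideal.span {c})ˣ) : _) := by
    intro y Y hY
    rw [invMod, mk_rep, ← hY, Ring.inverse_unit]
  have hψX : (ψ.mulShift X).IsPrimitive := by
    intro a ha h
    apply hψ (a := X * a)
    · rwa [Ne, Units.mul_right_eq_zero]
    · rw [← h, AddChar.mulShift_mulShift]
  have hmain := hP (ψ.mulShift X) hψX (-(M * X⁻¹ * t3⁻¹))
  have hX1 : (X : OK ⧸ Ideal.span {c}) * ((X⁻¹ : (OK ⧸ Ideal.span {c})ˣ) : _) = 1 := X.mul_inv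
  have ht1 : (3 : OK ⧸ Ideal.span {c}) * ((t3⁻¹ : (OK ⧸ Ideal.span {c})ˣ) : _) = 1 := by
    have := t3.mul_inv
    rwa [ht3, map_ofNat] at this
  rw [← finsum_comp_equiv (Equiv.mulLeft X⁻¹)] at hmain
  have eL : ∀ r : OK ⧸ Ideal.span {c},
      eC (((x * rep r ^ 3 + m * rep r : OK) : ℂ) / (c : ℂ)) =
      ψ.mulShift X (r ^ 3 - 3 * ((-(M * X⁻¹ * t3⁻¹) : (OK ⧸ Ideal.span {c})ˣ) : _) * r) := by
    intro r
    rw [← hψe, AddChar.mulShift_apply]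
    congr 1
    rw [map_add, map_mul, map_mul, map_pow, mk_rep, ← hX, ← hM]
    push_cast
    linear_combination -(M : OK ⧸ Ideal.span {c}) * r * hX1 -
      (M : OK ⧸ Ideal.span {c}) * r * X * ((X⁻¹ : (OK ⧸ Ideal.span {c})ˣ) : _) * ht1
  have eR : ∀ w : (OK ⧸ Ideal.span {c})ˣ,
      ((cubicChar c (invMod c x * rep w.val) : OK) : ℂ) *
        eC (((rep w.val - m ^ 3 * invMod c (3 ^ 3 * x * rep w.val) : OK) : ℂ) / (c : ℂ)) =
      chiS s (rep ((Equiv.mulLeft X⁻¹ w : (OK ⧸ Ideal.span {c})ˣ) : OK ⧸ Ideal.span {c})) *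
      ψ.mulShift X (((Equiv.mulLeft X⁻¹ w : (OK ⧸ Ideal.span {c})ˣ) : OK ⧸ Ideal.span {c}) +
        ((-(M * X⁻¹ * t3⁻¹) : (OK ⧸ Ideal.span {c})ˣ) : OK ⧸ Ideal.span {c}) ^ 3 *
        (((Equiv.mulLeft X⁻¹ w)⁻¹ : (OK ⧸ Ideal.span {c})ˣ) : OK ⧸ Ideal.span {c})) := by
    intro w
    rw [hchar]
    congr 1
    · apply chiS_congr
      intro p hp
      refine (hsc p hp).trans ?_
      rw [← mk_eq_iff, map_mul, hinv x X hX, mk_rep, mk_rep]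
      simp
    · rw [← hψe, AddChar.mulShift_apply]
      congr 1
      rw [map_sub, map_mul, map_pow, mk_rep, ← hM,
        hinv _ (t3 ^ 3 * X * w) (by push_cast; rw [map_mul, map_mul, map_pow, mk_rep, ht3, hX])]
      have hA : (t3 ^ 3 * X * w)⁻¹ = w⁻¹ * (X⁻¹ * t3⁻¹ ^ 3) := by
        rw [mul_inv_rev, mul_inv_rev, inv_pow]
      have hB : (X⁻¹ * w)⁻¹ = w⁻¹ * X := by
        rw [mul_inv_rev, inv_inv]
      simp only [Equiv.coe_mulLeft, hA, hB, Units.val_mul, Units.val_neg,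
        Units.val_pow_eq_pow_val]
      set Xi := ((X⁻¹ : (OK ⧸ Ideal.span {c})ˣ) : OK ⧸ Ideal.span {c})
      set ti := ((t3⁻¹ : (OK ⧸ Ideal.span {c})ˣ) : OK ⧸ Ideal.span {c})
      set wi := ((w⁻¹ : (OK ⧸ Ideal.span {c})ˣ) : OK ⧸ Ideal.span {c})
      linear_combination (-(w : OK ⧸ Ideal.span {c}) +
        M ^ 3 * ti ^ 3 * wi * Xi * (X * Xi + 1)) * hX1
  rw [finsum_congr eL, finsum_congr eR]
  exact hmain

end CubicSeries
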